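/- Let M be a matroid with a connected restriction on an edge-set partitioned into components, and let C₁, ..., C_t be an ear decomposition of a connected matroid M. Then for 2 ≤ i ≤ t one has r(D_i) − r(D_{i−1}) = |C̃_i| − 1, where D_j = C₁ ∪ ... ∪ C_j and C̃_i = C_i ∖ D_{i−1}. -/

import Mathlib

/-- A circuit of a matroid: a minimal dependent set. -/
def Matroid.IsCircuitSet {α : Type*} (M : Matroid α) (C : Set α) : Prop :=
  M.Dep C ∧ ∀ x ∈ C, M.Indep (C \ {x})

/-- The rank (in `ℕ∞`) of a set in a matroid: the supremum of the cardinalities of its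
independent subsets. -/
noncomputable def Matroid.rankOf {α : Type*} (M : Matroid α) (X : Set α) : ℕ∞ :=
  ⨆ I ∈ {I : Set α | M.Indep I ∧ I ⊆ X}, I.encard

/-- `D C j = C₁ ∪ ⋯ ∪ C_j`. -/
def earUnion {α : Type*} (C : ℕ → Set α) (j : ℕ) : Set α :=
  ⋃ l ∈ Set.Icc 1 j, C l

theorem Matroid.isCircuitSet_iff_aux {α : Type*} (M : Matroid α) (C : Set α) :
    M.IsCircuitSet C ↔ M.IsCircuit C :=
  Matroid.isCircuit_iff_dep_forall_sdiff_singleton_indep.symm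

theorem Matroid.rankOf_eq_eRk_aux {α : Type*} (M : Matroid α) (X : Set α) :
    M.rankOf X = M.eRk X := by
  unfold Matroid.rankOf
  apply le_antisymm
  · exact iSup₂_le fun I hI => Matroid.Indep.encard_le_eRk_of_subset hI.1 hI.2
  · obtain ⟨I, hI⟩ := M.exists_isBasis' X
    rw [← hI.encard_eq_eRk]
    exact le_iSup₂_of_le (f := fun (I : Set α) (_ : I ∈ {I : Set α | M.Indep I ∧ I ⊆ X}) => I.encard)
      I ⟨hI.indep, hI.subset⟩ le_rfl

theorem Matroid.ear_step_aux {α : Type*} (M : Matroid α) (D C : Set α) (hD : D ⊆ M.E)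
    (hC : M.IsCircuit C) (h2 : (C \ D).Nonempty)
    (h3 : ∀ C' : Set α, M.IsCircuit C' → (C' ∩ D).Nonempty → (C' \ D).Nonempty →
      ¬ (C' \ D) ⊂ (C \ D)) :
    M.eRk (D ∪ C) + 1 = M.eRk D + (C \ D).encard := by
  obtain ⟨I, hI⟩ := M.exists_isBasis D
  obtain ⟨e, heC, heD⟩ := h2
  have hsub : I ∪ ((C \ D) \ {e}) ⊆ M.E :=
    Set.union_subset (hI.subset.trans hD)
      (Set.sdiff_subset.trans (Set.sdiff_subset.trans hC.subset_ground))
  have hind : M.Indep (I ∪ ((C \ D) \ {e})) := by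
    by_contra hn
    obtain ⟨C', hC'sub, hC'⟩ :=
      ((Matroid.not_indep_iff hsub).1 hn).exists_isCircuit_subset
    have hID := hI.subset
    have hsd : C' \ D ⊆ (C \ D) \ {e} := by
      intro x hx
      rcases hC'sub hx.1 with h | h
      · exact absurd (hID h) hx.2
      · exact h
    have hne : (C' \ D).Nonempty := by
      by_contra hemp
      rw [Set.not_nonempty_iff_eq_empty, Set.sdiff_eq_empty] at hemp
      refine hC'.not_indep (hI.indep.subset fun x hx => ?_)
      rcases hC'sub hx with h | h
      · exact h
      · exact absurd (hemp hx) h.1.2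
    have hss : C' \ D ⊂ C \ D :=
      ⟨hsd.trans Set.sdiff_subset, fun h => (hsd (h ⟨heC, heD⟩)).2 rfl⟩
    by_cases hint : (C' ∩ D).Nonempty
    · exact h3 C' hC' hint hne hss
    · have hCC : C' ⊆ (C \ D) \ {e} := fun x hx => hsd ⟨hx, fun hxD => hint ⟨x, hx, hxD⟩⟩
      exact hC.not_ssubset hC' ⟨fun x hx => (hCC hx).1.1, fun h => (hCC (h heC)).2 rfl⟩
  have hDcl : D ⊆ M.closure (I ∪ ((C \ D) \ {e})) :=
    hI.subset_closure.trans (M.closure_subset_closure Set.subset_union_left)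
  have hCe : C \ {e} ⊆ M.closure (I ∪ ((C \ D) \ {e})) := by
    intro x hx
    by_cases hxD : x ∈ D
    · exact hDcl hxD
    · exact M.subset_closure _ hsub (Or.inr ⟨⟨hx.1, hxD⟩, hx.2⟩)
  have hCcl : C ⊆ M.closure (I ∪ ((C \ D) \ {e})) :=
    (hC.sdiff_singleton_isBasis heC).subset_closure.trans
      (M.closure_subset_closure_of_subset_closure hCe)
  have hbas : M.IsBasis (I ∪ ((C \ D) \ {e})) (D ∪ C) :=
    hind.isBasis_of_subset_of_subset_closure
      (Set.union_subset_union hI.subset (fun x hx => hx.1.1)) (Set.union_subset hDcl hCcl)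
  have hdisj : Disjoint I ((C \ D) \ {e}) :=
    Set.disjoint_left.2 fun x hx hx' => hx'.1.2 (hI.subset hx)
  rw [← hbas.encard_eq_eRk, ← hI.encard_eq_eRk, Set.encard_union_eq hdisj, add_assoc,
    Set.encard_sdiff_singleton_add_one (show e ∈ C \ D from ⟨heC, heD⟩)]

/-- Lemma lem:EDfacts (c). If `C₁, …, C_t` is an ear decomposition of a
connected matroid `M`, then `r(D_i) − r(D_{i−1}) = |C̃_i| − 1` for `2 ≤ i ≤ t`, stated
additively as `r(D_i) + 1 = r(D_{i−1}) + |C_i ∖ D_{i−1}|`. -/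
theorem ear_decomposition_rank_step
    {α : Type*} (M : Matroid α) (t : ℕ) (C : ℕ → Set α)
    (hconn : ∀ e ∈ M.E, ∀ f ∈ M.E, e ≠ f →
      ∃ C', M.IsCircuitSet C' ∧ e ∈ C' ∧ f ∈ C')
    (hcirc : ∀ i, 1 ≤ i → i ≤ t → M.IsCircuitSet (C i))
    (hE1 : ∀ i, 2 ≤ i → i ≤ t → (C i ∩ earUnion C (i - 1)).Nonempty)
    (hE2 : ∀ i, 2 ≤ i → i ≤ t → (C i \ earUnion C (i - 1)).Nonempty)
    (hE3 : ∀ i, 2 ≤ i → i ≤ t → ∀ C' : Set α, M.IsCircuitSet C' →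
      (C' ∩ earUnion C (i - 1)).Nonempty → (C' \ earUnion C (i - 1)).Nonempty →
      ¬ (C' \ earUnion C (i - 1)) ⊂ (C i \ earUnion C (i - 1)))
    (hground : earUnion C t = M.E) :
    ∀ i, 2 ≤ i → i ≤ t →
      M.rankOf (earUnion C i) + 1 =
        M.rankOf (earUnion C (i - 1)) + (C i \ earUnion C (i - 1)).encard := by
  intro i hi hit
  rw [Matroid.rankOf_eq_eRk_aux, Matroid.rankOf_eq_eRk_aux]
  have hU : earUnion C i = earUnion C (i - 1) ∪ C i := by
    ext x
    simp only [earUnion, Set.mem_iUnion, Set.mem_Icc, Set.mem_union, exists_prop]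
    constructor
    · rintro ⟨l, ⟨h1, h2⟩, hx⟩
      rcases Nat.lt_or_ge l i with h | h
      · exact Or.inl ⟨l, ⟨h1, by omega⟩, hx⟩
      · obtain rfl : l = i := le_antisymm h2 h
        exact Or.inr hx
    · rintro (⟨l, ⟨h1, h2⟩, hx⟩ | hx)
      · exact ⟨l, ⟨h1, by omega⟩, hx⟩
      · exact ⟨i, ⟨by omega, le_rfl⟩, hx⟩
  have hD : earUnion C (i - 1) ⊆ M.E := by
    refine Set.iUnion₂_subset fun l hl => ?_
    rw [Set.mem_Icc] at hl
    exact (hcirc l hl.1 (by omega)).1.subset_ground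
  rw [hU]
  exact M.ear_step_aux _ _ hD ((M.isCircuitSet_iff_aux _).1 (hcirc i (by omega) hit))
    (hE2 i hi hit) fun C' hC' => hE3 i hi hit C' ((M.isCircuitSet_iff_aux _).2 hC')
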